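/- Let q ∈ ℂ be nonzero and not a root of unity, let A be a unital associative ℂ-algebra, and let a, b, c, d ∈ A satisfy the SL_q(2) relations. Then for every natural number n, $\sum_{j=0}^{n}\binom{n}{j}_{q^2}(-q)^{-j}\,a^{n-j}c^{j}b^{j}d^{n-j} = 1$ and $\sum_{j=0}^{n}\binom{n}{j}_{q^2}(-q)^{j}\,b^{j}d^{n-j}a^{n-j}c^{j} = 1$. (These are the 'row times column equals 1' identities underlying the idempotency of the projector matrices $e_{\pm n}$ and $f_{\pm n}$ of the quantum Hopf line bundles.) -/

import Mathlib

/-- The `x`-binomial coefficient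
`(x-1)(x²-1)⋯(xⁿ-1) / [(x-1)⋯(x^j-1) · (x-1)⋯(x^(n-j)-1)]`. -/
noncomputable def qbin (x : ℂ) (n k : ℕ) : ℂ :=
  (∏ i ∈ Finset.range n, (x ^ (i + 1) - 1)) /
    ((∏ i ∈ Finset.range k, (x ^ (i + 1) - 1)) *
      (∏ i ∈ Finset.range (n - k), (x ^ (i + 1) - 1)))

theorem qbin_zero_right {x : ℂ} (hx : ∀ k : ℕ, x ^ (k + 1) - 1 ≠ 0) (n : ℕ) :
    qbin x n 0 = 1 := by
  have h : ∏ i ∈ Finset.range n, (x ^ (i + 1) - 1) ≠ 0 :=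
    Finset.prod_ne_zero_iff.mpr fun i _ => hx i
  simp [qbin, h]

theorem qbin_self {x : ℂ} (hx : ∀ k : ℕ, x ^ (k + 1) - 1 ≠ 0) (n : ℕ) :
    qbin x n n = 1 := by
  have h : ∏ i ∈ Finset.range n, (x ^ (i + 1) - 1) ≠ 0 :=
    Finset.prod_ne_zero_iff.mpr fun i _ => hx i
  simp [qbin, h]

theorem qbin_succ_succ {x : ℂ} (hx : ∀ k : ℕ, x ^ (k + 1) - 1 ≠ 0) {n k : ℕ} (hk : k < n) :
    qbin x (n + 1) (k + 1) = qbin x n (k + 1) + x ^ (n - k) * qbin x n k := by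
  obtain ⟨m, rfl⟩ := Nat.exists_eq_add_of_lt hk
  have hP : ∀ n : ℕ, ∏ i ∈ Finset.range n, (x ^ (i + 1) - 1) ≠ 0 := fun n =>
    Finset.prod_ne_zero_iff.mpr fun i _ => hx i
  have e1 : k + m + 1 + 1 - (k + 1) = m + 1 := by omega
  have e2 : k + m + 1 - (k + 1) = m := by omega
  have e3 : k + m + 1 - k = m + 1 := by omega
  simp only [qbin, e1, e2, e3]
  rw [Finset.prod_range_succ _ (k + m + 1), Finset.prod_range_succ _ k,
    Finset.prod_range_succ _ m]
  have h1 := hP k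
  have h2 := hP m
  have h3 := hx k
  have h4 := hx m
  field_simp
  ring

theorem qbin_succ_succ' {x : ℂ} (hx : ∀ k : ℕ, x ^ (k + 1) - 1 ≠ 0) {n k : ℕ} (hk : k < n) :
    qbin x (n + 1) (k + 1) = x ^ (k + 1) * qbin x n (k + 1) + qbin x n k := by
  obtain ⟨m, rfl⟩ := Nat.exists_eq_add_of_lt hk
  have hP : ∀ n : ℕ, ∏ i ∈ Finset.range n, (x ^ (i + 1) - 1) ≠ 0 := fun n =>
    Finset.prod_ne_zero_iff.mpr fun i _ => hx i
  have e1 : k + m + 1 + 1 - (k + 1) = m + 1 := by omega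
  have e2 : k + m + 1 - (k + 1) = m := by omega
  have e3 : k + m + 1 - k = m + 1 := by omega
  simp only [qbin, e1, e2, e3]
  rw [Finset.prod_range_succ _ (k + m + 1), Finset.prod_range_succ _ k,
    Finset.prod_range_succ _ m]
  have h1 := hP k
  have h2 := hP m
  have h3 := hx k
  have h4 := hx m
  field_simp
  ring

theorem sum_range_eq_add_of_pascal {M : Type*} [AddCommMonoid M] (n : ℕ) (F G H : ℕ → M)
    (h0 : F 0 = G 0) (hn : F (n + 1) = H n) (hm : ∀ k < n, F (k + 1) = G (k + 1) + H k) :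
    ∑ j ∈ Finset.range (n + 2), F j =
      ∑ j ∈ Finset.range (n + 1), G j + ∑ j ∈ Finset.range (n + 1), H j := by
  rw [Finset.sum_range_succ, Finset.sum_range_succ', Finset.sum_range_succ' G,
    Finset.sum_range_succ H, h0, hn,
    Finset.sum_congr rfl fun k hk => hm k (Finset.mem_range.mp hk), Finset.sum_add_distrib]
  abel

section SkewCommute

variable {R A : Type*} [CommSemiring R] [Semiring A] [Algebra R A]

theorem mul_pow_of_mul_eq_smul {r : R} {u v : A} (h : u * v = r • (v * u)) (m : ℕ) :
    u * v ^ m = r ^ m • (v ^ m * u) := by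
  induction m with
  | zero => simp
  | succ m ih =>
    rw [pow_succ, ← mul_assoc, ih, smul_mul_assoc, mul_assoc, h, mul_smul_comm, smul_smul,
      ← mul_assoc, ← pow_succ]

theorem pow_mul_of_mul_eq_smul {r : R} {u v : A} (h : u * v = r • (v * u)) (m : ℕ) :
    u ^ m * v = r ^ m • (v * u ^ m) := by
  induction m with
  | zero => simp
  | succ m ih =>
    rw [pow_succ', mul_assoc, ih, mul_smul_comm, ← mul_assoc, h, smul_mul_assoc, smul_smul,
      mul_assoc, ← pow_succ, ← pow_succ']

end SkewCommute

theorem stmt19 (q : ℂ) (hq : q ≠ 0) (hroot : ∀ k : ℕ, 0 < k → q ^ k ≠ 1)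
    (A : Type*) [Ring A] [Algebra ℂ A] (a b c d : A)
    (hab : a * b = q⁻¹ • (b * a)) (hac : a * c = q⁻¹ • (c * a))
    (hbd : b * d = q⁻¹ • (d * b)) (hbc : b * c = c * b)
    (hcd : c * d = q⁻¹ • (d * c))
    (hadda : a * d - d * a = (q⁻¹ - q) • (b * c))
    (had : a * d - q⁻¹ • (b * c) = 1) (hda : d * a - q • (b * c) = 1)
    (n : ℕ) :
    (∑ j ∈ Finset.range (n + 1),
        (qbin (q ^ 2) n j * (-q) ^ (-(j : ℤ))) • (a ^ (n - j) * c ^ j * b ^ j * d ^ (n - j))) = 1 ∧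
    (∑ j ∈ Finset.range (n + 1),
        (qbin (q ^ 2) n j * (-q) ^ j) • (b ^ j * d ^ (n - j) * a ^ (n - j) * c ^ j)) = 1 := by
  have hx : ∀ k : ℕ, (q ^ 2) ^ (k + 1) - 1 ≠ 0 := fun k h =>
    hroot (2 * (k + 1)) (by omega) (by rw [pow_mul]; exact sub_eq_zero.mp h)
  have hq' : -q ≠ 0 := neg_ne_zero.mpr hq
  have hca : c * a = q • (a * c) := by rw [hac, smul_smul, mul_inv_cancel₀ hq, one_smul]
  have hdb : d * b = q • (b * d) := by rw [hbd, smul_smul, mul_inv_cancel₀ hq, one_smul]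
  constructor
  · induction n with
    | zero => simp [qbin]
    | succ n ih =>
      have hT : ∀ m j : ℕ, c * (a ^ m * c ^ j * b ^ j * d ^ m) * b =
          (q ^ 2) ^ m • (a ^ m * c ^ (j + 1) * b ^ (j + 1) * d ^ m) := by
        intro m j
        calc c * (a ^ m * c ^ j * b ^ j * d ^ m) * b
            = (c * a ^ m) * (c ^ j * b ^ j) * (d ^ m * b) := by simp only [mul_assoc]
          _ = (q ^ 2) ^ m • (a ^ m * (c * c ^ j) * (b ^ j * b) * d ^ m) := by
            rw [mul_pow_of_mul_eq_smul hca, pow_mul_of_mul_eq_smul hdb]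
            simp only [smul_mul_assoc, mul_smul_comm, smul_smul]
            congr 1
            · ring
            · simp only [mul_assoc]
          _ = _ := by rw [← pow_succ', ← pow_succ]
      rw [sum_range_eq_add_of_pascal n _
        (fun j => a * ((qbin (q ^ 2) n j * (-q) ^ (-(j : ℤ))) •
          (a ^ (n - j) * c ^ j * b ^ j * d ^ (n - j))) * d)
        (fun j => (-q)⁻¹ • (c * ((qbin (q ^ 2) n j * (-q) ^ (-(j : ℤ))) •
          (a ^ (n - j) * c ^ j * b ^ j * d ^ (n - j))) * b)),
        ← Finset.smul_sum, ← Finset.sum_mul, ← Finset.mul_sum, ← Finset.sum_mul,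
        ← Finset.mul_sum, ih, mul_one, mul_one, ← hbc, inv_neg, neg_smul, ← sub_eq_add_neg, had]
      · simp [qbin_zero_right hx, pow_succ' a, pow_succ d, mul_assoc]
      · simp only [mul_smul_comm, smul_mul_assoc, smul_smul, qbin_self hx, Nat.sub_self,
          pow_zero, one_mul, mul_one]
        congr 1
        · rw [Nat.cast_succ, neg_add, zpow_add₀ hq', zpow_neg_one, mul_comm]
        · simp only [pow_succ' c, pow_succ b, mul_assoc]
      · intro k hk
        obtain ⟨m, rfl⟩ := Nat.exists_eq_add_of_lt hk
        have e1 : k + m + 1 + 1 - (k + 1) = m + 1 := by omega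
        have e2 : k + m + 1 - (k + 1) = m := by omega
        have e3 : k + m + 1 - k = m + 1 := by omega
        have hA : a * (a ^ m * c ^ (k + 1) * b ^ (k + 1) * d ^ m) * d =
            a ^ (m + 1) * c ^ (k + 1) * b ^ (k + 1) * d ^ (m + 1) := by
          simp only [pow_succ' a, pow_succ d, mul_assoc]
        simp only [mul_smul_comm, smul_mul_assoc, e1, e2, e3, hT, hA, smul_smul]
        rw [← add_smul, qbin_succ_succ hx hk, e3, Nat.cast_succ, neg_add, zpow_add₀ hq',
          zpow_neg_one]
        congr 1
        ring
  · induction n with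
    | zero => simp [qbin]
    | succ n ih =>
      have hT : ∀ m j : ℕ, d * (b ^ j * d ^ m * a ^ m * c ^ j) * a =
          (q ^ 2) ^ j • (b ^ j * d ^ (m + 1) * a ^ (m + 1) * c ^ j) := by
        intro m j
        calc d * (b ^ j * d ^ m * a ^ m * c ^ j) * a
            = (d * b ^ j) * (d ^ m * a ^ m) * (c ^ j * a) := by simp only [mul_assoc]
          _ = (q ^ 2) ^ j • (b ^ j * (d * d ^ m) * (a ^ m * a) * c ^ j) := by
            rw [mul_pow_of_mul_eq_smul hdb, pow_mul_of_mul_eq_smul hca]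
            simp only [smul_mul_assoc, mul_smul_comm, smul_smul]
            congr 1
            · ring
            · simp only [mul_assoc]
          _ = _ := by rw [← pow_succ', ← pow_succ]
      have hB : ∀ m j : ℕ, b * (b ^ j * d ^ m * a ^ m * c ^ j) * c =
          b ^ (j + 1) * d ^ m * a ^ m * c ^ (j + 1) := by
        intro m j
        simp only [pow_succ' b, pow_succ c, mul_assoc]
      rw [sum_range_eq_add_of_pascal n _
        (fun j => d * ((qbin (q ^ 2) n j * (-q) ^ j) •
          (b ^ j * d ^ (n - j) * a ^ (n - j) * c ^ j)) * a)
        (fun j => (-q) • (b * ((qbin (q ^ 2) n j * (-q) ^ j) •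
          (b ^ j * d ^ (n - j) * a ^ (n - j) * c ^ j)) * c)),
        ← Finset.smul_sum, ← Finset.sum_mul, ← Finset.mul_sum, ← Finset.sum_mul,
        ← Finset.mul_sum, ih, mul_one, mul_one, neg_smul, ← sub_eq_add_neg, hda]
      · simp [qbin_zero_right hx, pow_succ' d, pow_succ a, mul_assoc]
      · simp only [mul_smul_comm, smul_mul_assoc, hB, smul_smul, qbin_self hx, Nat.sub_self,
          one_mul, pow_succ' (-q)]
      · intro k hk
        obtain ⟨m, rfl⟩ := Nat.exists_eq_add_of_lt hk
        have e1 : k + m + 1 + 1 - (k + 1) = m + 1 := by omega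
        have e2 : k + m + 1 - (k + 1) = m := by omega
        have e3 : k + m + 1 - k = m + 1 := by omega
        simp only [mul_smul_comm, smul_mul_assoc, e1, e2, e3, hT, hB, smul_smul]
        rw [← add_smul, qbin_succ_succ' hx hk]
        congr 1
        ring
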